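/- (Adams) Let 0 < α < n, 1 < q ≤ p < ∞ and 1 < l ≤ s < ∞ with 1/s = 1/p − α/n and l/s = q/p. Then there is a constant C, depending only on n, α, p, q, such that for every nonnegative measurable function f on ℝⁿ, ‖I_α f‖_{M^s_l} ≤ C ‖f‖_{M^p_q}. -/

import Mathlib

open MeasureTheory ENNReal

noncomputable section

/-- `ℝⁿ` with the Euclidean norm. -/
abbrev En (n : ℕ) := EuclideanSpace ℝ (Fin n)

/-- The open cube in `ℝⁿ` centered at `c` with half side length `r`. -/
def cube {n : ℕ} (c : En n) (r : ℝ) : Set (En n) := {y | ∀ i, |y i - c i| < r}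

/-- Morrey norm `‖f‖_{M^p_q}`. -/
def morreyNorm {n : ℕ} (p q : ℝ) (f : En n → ℂ) : ℝ≥0∞ :=
  ⨆ (c : En n) (r : ℝ) (_ : 0 < r),
    volume (cube c r) ^ (1 / p - 1 / q) *
      (∫⁻ y in cube c r, (‖f y‖₊ : ℝ≥0∞) ^ q) ^ (1 / q)

/-- Weak Morrey norm `‖f‖_{WM^p_q}`. -/
def weakMorreyNorm {n : ℕ} (p q : ℝ) (f : En n → ℂ) : ℝ≥0∞ :=
  ⨆ (c : En n) (r : ℝ) (_ : 0 < r),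
    volume (cube c r) ^ (1 / p - 1 / q) *
      ⨆ (t : ℝ) (_ : 0 < t),
        (ENNReal.ofReal t ^ q * volume {y ∈ cube c r | t < ‖f y‖}) ^ (1 / q)

/-- Weak Lebesgue quasinorm `‖f‖_{L^{p,∞}}`. -/
def weakLpNorm {n : ℕ} (p : ℝ) (f : En n → ℂ) : ℝ≥0∞ :=
  ⨆ (t : ℝ) (_ : 0 < t),
    ENNReal.ofReal t * volume {x : En n | t < ‖f x‖} ^ (1 / p)

/-- The average `b_Q` of `b` over the cube `Q = cube c r`. -/
def cubeAvg {n : ℕ} (b : En n → ℝ) (c : En n) (r : ℝ) : ℝ :=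
  (∫ x in cube c r, b x) / (volume (cube c r)).toReal

/-- The BMO seminorm `‖b‖_*`. -/
def bmoSeminorm {n : ℕ} (b : En n → ℝ) : ℝ≥0∞ :=
  ⨆ (c : En n) (r : ℝ) (_ : 0 < r),
    (volume (cube c r))⁻¹ *
      ∫⁻ x in cube c r, (‖b x - cubeAvg b c r‖₊ : ℝ≥0∞)

/-- The Lipschitz (Hölder) seminorm `‖b‖_{Lip_α}`. -/
def lipSeminorm {n : ℕ} (α : ℝ) (b : En n → ℝ) : ℝ≥0∞ :=
  ⨆ (x : En n) (y : En n) (_ : x ≠ y),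
    (‖b x - b y‖₊ : ℝ≥0∞) / edist x y ^ α

/-- `sup_Q |Q|^{-(1+α/n)} ∫_Q |b - b_Q|`. -/
def lipAvgNorm {n : ℕ} (α : ℝ) (b : En n → ℝ) : ℝ≥0∞ :=
  ⨆ (c : En n) (r : ℝ) (_ : 0 < r),
    volume (cube c r) ^ (-(1 + α / (n : ℝ))) *
      ∫⁻ x in cube c r, (‖b x - cubeAvg b c r‖₊ : ℝ≥0∞)

/-- The fractional integral `I_α g (x) = ∫ g(y) / |x-y|^{n-α} dy` of a nonnegative function. -/
def fracIntegral {n : ℕ} (α : ℝ) (g : En n → ℝ≥0∞) (x : En n) : ℝ≥0∞ :=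
  ∫⁻ y, g y / edist x y ^ ((n : ℝ) - α)

/-- Morrey norm `‖g‖_{M^p_q}` of a nonnegative (extended-real-valued) function. -/
def morreyNormE {n : ℕ} (p q : ℝ) (g : En n → ℝ≥0∞) : ℝ≥0∞ :=
  ⨆ (c : En n) (r : ℝ) (_ : 0 < r),
    volume (cube c r) ^ (1 / p - 1 / q) * (∫⁻ y in cube c r, g y ^ q) ^ (1 / q)

lemma e_add (x y : ℝ) : (2:ℝ≥0∞) ^ (x + y) = 2 ^ x * 2 ^ y :=
  ENNReal.rpow_add _ _ (by norm_num) (by norm_num)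

lemma e_ne_zero (x : ℝ) : (2:ℝ≥0∞) ^ x ≠ 0 := by
  simp [ENNReal.rpow_eq_zero_iff]

lemma e_ne_top (x : ℝ) : (2:ℝ≥0∞) ^ x ≠ ⊤ := by
  simp [ENNReal.rpow_eq_top_iff]

lemma e_mono {x y : ℝ} (h : x ≤ y) : (2:ℝ≥0∞) ^ x ≤ 2 ^ y :=
  ENNReal.rpow_le_rpow_of_exponent_le (by norm_num) h

/-- The two-sided geometric series. -/
def SS (γ : ℝ) : ℝ≥0∞ := ∑' j : ℤ, (2:ℝ≥0∞) ^ (-(γ * |(j:ℝ)|))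

lemma SS_ne_top {γ : ℝ} (hγ : 0 < γ) : SS γ ≠ ⊤ := by
  have h1 : Summable (fun n : ℕ => ((2:ℝ) ^ (-γ)) ^ n) :=
    summable_geometric_of_lt_one (by positivity)
      (Real.rpow_lt_one_of_one_lt_of_neg (by norm_num) (by linarith))
  have h2 : ∀ n : ℕ, (2:ℝ) ^ (-(γ * |(n:ℝ)|)) = ((2:ℝ) ^ (-γ)) ^ n := by
    intro n
    rw [← Real.rpow_natCast, ← Real.rpow_mul (by norm_num), abs_of_nonneg (by positivity)]
    congr 1; ring
  have h : Summable (fun j : ℤ => (2:ℝ) ^ (-(γ * |(j:ℝ)|))) := by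
    apply Summable.of_nat_of_neg
    · simp only [Int.cast_natCast, h2]; exact h1
    · simp only [Int.cast_neg, Int.cast_natCast, abs_neg, h2]; exact h1
  have h3 := h.tsum_ofReal_ne_top
  unfold SS
  convert h3 using 4 with j
  rw [← ENNReal.ofReal_rpow_of_pos (by norm_num)]
  norm_num

lemma SS_shift (γ : ℝ) (m : ℤ) :
    ∑' j : ℤ, (2:ℝ≥0∞) ^ (-(γ * |(j:ℝ) - m|)) = SS γ := by
  unfold SS
  rw [← (Equiv.subRight m).tsum_eq (fun j : ℤ => (2:ℝ≥0∞) ^ (-(γ * |(j:ℝ)|)))]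
  simp

lemma minsum {α β : ℝ} (hα : 0 < α) (hβ : 0 < β) (a b : ℝ≥0∞) :
    ∑' k : ℤ, min (a * 2 ^ (k * α)) (b * 2 ^ (-(k * β))) ≤
      (2 ^ β * SS (min α β)) * (a ^ (β / (α + β)) * b ^ (α / (α + β))) := by
  have hs : 0 < α + β := by linarith
  have hθ : 0 < β / (α + β) := by positivity
  have hθ' : 0 < α / (α + β) := by positivity
  have hsum : β / (α + β) + α / (α + β) = 1 := by field_simp; ring
  have hS : SS (min α β) ≠ 0 := by
    unfold SS
    intro h
    rw [ENNReal.tsum_eq_zero] at h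
    exact e_ne_zero _ (h 0)
  have hK : (2:ℝ≥0∞) ^ β * SS (min α β) ≠ 0 := mul_ne_zero (e_ne_zero _) hS
  rcases eq_or_ne a 0 with rfl | ha0
  · simp
  rcases eq_or_ne b 0 with rfl | hb0
  · simp
  rcases eq_or_ne a ⊤ with rfl | hat
  · rw [ENNReal.top_rpow_of_pos hθ, ENNReal.top_mul, ENNReal.mul_top hK]
    · exact le_top
    · simp [ENNReal.rpow_eq_zero_iff, hb0, hθ'.le]
  rcases eq_or_ne b ⊤ with rfl | hbt
  · rw [ENNReal.top_rpow_of_pos hθ', ENNReal.mul_top, ENNReal.mul_top hK]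
    · exact le_top
    · simp [ENNReal.rpow_eq_zero_iff, ha0, hθ.le]
  set G := a ^ (β / (α + β)) * b ^ (α / (α + β)) with hG
  obtain ⟨k0, hk1, hk2⟩ := ENNReal.exists_mem_Ico_zpow (x := b / a) (y := (2:ℝ≥0∞) ^ (α + β))
    (by simp [hb0, hat]) (by simp [ENNReal.div_eq_top, hbt, ha0])
    (ENNReal.one_lt_rpow (by norm_num) hs) (e_ne_top _)
  rw [← ENNReal.rpow_intCast, ← ENNReal.rpow_mul] at hk1 hk2
  rw [ENNReal.le_div_iff_mul_le (Or.inl ha0) (Or.inl hat)] at hk1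
  have hk2 := (ENNReal.div_le_iff ha0 hat).1 hk2.le
  have A1 : a * 2 ^ (k0 * α) ≤ G := by
    have := ENNReal.rpow_le_rpow hk1 hθ'.le
    rw [ENNReal.mul_rpow_of_nonneg _ _ hθ'.le, ← ENNReal.rpow_mul] at this
    have e1 : (α + β) * (k0:ℝ) * (α / (α + β)) = k0 * α := by field_simp
    rw [e1] at this
    calc a * 2 ^ (k0 * α) = a ^ (β / (α + β)) * (2 ^ (k0 * α) * a ^ (α / (α + β))) := by
          conv_lhs => rw [← ENNReal.rpow_one a, ← hsum, ENNReal.rpow_add _ _ ha0 hat]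
          ring
      _ ≤ _ := by rw [hG]; gcongr
  have A2 : b * 2 ^ (-((k0 + 1) * β)) ≤ G := by
    have := ENNReal.rpow_le_rpow hk2 hθ.le
    rw [ENNReal.mul_rpow_of_nonneg _ _ hθ.le, ← ENNReal.rpow_mul] at this
    have e1 : (α + β) * ((k0 + 1 : ℤ):ℝ) * (β / (α + β)) = (k0 + 1) * β := by
      push_cast; field_simp
    rw [e1] at this
    calc b * 2 ^ (-((k0 + 1) * β))
        = b ^ (β / (α + β)) * 2 ^ (-((k0 + 1) * β)) * b ^ (α / (α + β)) := by
          have hb : b = b ^ (β / (α + β)) * b ^ (α / (α + β)) := by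
            rw [← ENNReal.rpow_add _ _ hb0 hbt, hsum, ENNReal.rpow_one]
          conv_lhs => rw [hb]
          ring
      _ ≤ (2 ^ ((k0 + 1) * β) * a ^ (β / (α + β))) * 2 ^ (-((k0 + 1) * β)) *
            b ^ (α / (α + β)) := by gcongr
      _ = (2 ^ ((k0 + 1) * β) * 2 ^ (-((k0 + 1) * β))) * G := by rw [hG]; ring
      _ = G := by rw [← e_add]; simp
  rw [← SS_shift _ k0, mul_comm _ G, ← mul_assoc, ← ENNReal.tsum_mul_left]
  refine ENNReal.tsum_le_tsum fun k => ?_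
  rcases le_total (k:ℝ) k0 with h | h
  · refine (min_le_left _ _).trans ?_
    calc a * 2 ^ (k * α) = (a * 2 ^ (k0 * α)) * 2 ^ ((k - k0) * α) := by
          rw [mul_assoc, ← e_add]; congr 2; ring
      _ ≤ G * 2 ^ (β - min α β * |(k:ℝ) - k0|) := by
          refine mul_le_mul' (by assumption) (e_mono ?_)
          rw [abs_of_nonpos (by linarith)]
          nlinarith [min_le_left α β]
      _ = _ := by rw [sub_eq_add_neg, e_add]; ring
  · refine (min_le_right _ _).trans ?_
    calc b * 2 ^ (-(k * β)) = (b * 2 ^ (-((k0 + 1) * β))) * 2 ^ (β + -((k - k0) * β)) := by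
          rw [mul_assoc, ← e_add]; congr 2; ring
      _ ≤ G * 2 ^ (β + - (min α β * |(k:ℝ) - k0|)) := by
          refine mul_le_mul' (by assumption) (e_mono ?_)
          rw [abs_of_nonneg (by linarith)]
          nlinarith [min_le_right α β]
      _ = _ := by rw [e_add]; ring

lemma layer_upper {q : ℝ} (hq : 0 < q) (y : ℝ≥0∞) :
    y ^ q ≤ ∑' j : ℤ, if (2:ℝ≥0∞) ^ (j:ℝ) < y then (2:ℝ≥0∞) ^ ((j + 1) * q) else 0 := by
  rcases eq_or_ne y 0 with rfl | h0
  · simp [hq]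
  rcases eq_or_ne y ⊤ with rfl | ht
  · refine le_trans le_top ?_
    refine le_trans ?_ (ENNReal.tsum_comp_le_tsum_of_injective (f := fun n : ℕ => (n : ℤ))
      Nat.cast_injective _)
    refine (ENNReal.tsum_const_eq_top_of_ne_zero (α := ℕ) (c := 1) one_ne_zero).ge.trans ?_
    refine ENNReal.tsum_le_tsum fun n => ?_
    rw [if_pos (lt_top_iff_ne_top.2 (e_ne_top _))]
    rw [← ENNReal.rpow_zero (x := 2)]
    apply e_mono
    push_cast
    positivity
  · obtain ⟨m, h1, h2⟩ := ENNReal.exists_mem_Ioc_zpow h0 ht (y := 2) (by norm_num) (by norm_num)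
    refine le_trans ?_ (ENNReal.le_tsum m)
    rw [← ENNReal.rpow_intCast] at h1 h2
    rw [if_pos h1, ENNReal.rpow_mul]
    push_cast at h2
    gcongr

lemma layer_lower {δ : ℝ} (hδ : 0 < δ) (y : ℝ≥0∞) :
    (∑' j : ℤ, if (2:ℝ≥0∞) ^ ((j:ℝ) - 1) < y then (2:ℝ≥0∞) ^ (j * δ) else 0)
      ≤ (2 ^ δ * SS δ) * y ^ δ := by
  have hS : SS δ ≠ 0 := by
    unfold SS
    intro h
    rw [ENNReal.tsum_eq_zero] at h
    exact e_ne_zero _ (h 0)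
  have hK : (2:ℝ≥0∞) ^ δ * SS δ ≠ 0 := mul_ne_zero (e_ne_zero _) hS
  rcases eq_or_ne y 0 with rfl | h0
  · simp
  rcases eq_or_ne y ⊤ with rfl | ht
  · rw [ENNReal.top_rpow_of_pos hδ, ENNReal.mul_top hK]; exact le_top
  obtain ⟨m, h1, h2⟩ := ENNReal.exists_mem_Ioc_zpow h0 ht (y := 2) (by norm_num) (by norm_num)
  rw [← ENNReal.rpow_intCast] at h1 h2
  have h1' : (2:ℝ≥0∞) ^ (m * δ) ≤ y ^ δ := by
    rw [ENNReal.rpow_mul]; gcongr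
  rw [← SS_shift _ (m + 1), mul_comm _ (y ^ δ), ← mul_assoc, ← ENNReal.tsum_mul_left]
  refine ENNReal.tsum_le_tsum fun j => ?_
  split_ifs with hj
  · have hlt := hj.trans_le h2
    have hle : (j:ℝ) - 1 ≤ m := by
      by_contra hcon
      have : m + 1 ≤ j - 1 := by
        have : m < j - 1 := by
          have := not_le.1 hcon
          exact_mod_cast this
        omega
      have h3 : ((m + 1 : ℤ):ℝ) ≤ (j:ℝ) - 1 := by exact_mod_cast this
      exact absurd (e_mono h3) (not_le.2 hlt)
    calc (2:ℝ≥0∞) ^ (j * δ) = 2 ^ (m * δ) * (2 ^ δ * 2 ^ (-(δ * |(j:ℝ) - (m + 1 : ℤ)|))) := by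
          rw [← e_add, ← e_add]; congr 1
          push_cast
          rw [abs_of_nonpos (by linarith)]; ring
      _ ≤ y ^ δ * (2 ^ δ * 2 ^ (-(δ * |(j:ℝ) - (m + 1 : ℤ)|))) := by gcongr
      _ = _ := by ring
  · exact zero_le

open Metric in
lemma vol_ball {n : ℕ} (x : En n) (k : ℤ) :
    volume (closedBall x ((2:ℝ) ^ (k:ℝ))) = 2 ^ (k * (n:ℝ)) * volume (ball (0 : En n) 1) := by
  rw [Measure.addHaar_closedBall _ _ (by positivity)]
  congr 1
  rw [finrank_euclideanSpace_fin, ENNReal.ofReal_pow (by positivity),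
    ← ENNReal.ofReal_rpow_of_pos (by norm_num), ENNReal.rpow_mul, ENNReal.rpow_natCast]
  norm_num

lemma om_ne_zero (n : ℕ) : volume (Metric.ball (0 : En n) 1) ≠ 0 :=
  (Metric.measure_ball_pos _ _ one_pos).ne'

lemma om_ne_top (n : ℕ) : volume (Metric.ball (0 : En n) 1) ≠ ⊤ := measure_ball_lt_top.ne

lemma vol_ne_zero {n : ℕ} (x : En n) (k : ℤ) :
    volume (Metric.closedBall x ((2:ℝ) ^ (k:ℝ))) ≠ 0 := by
  rw [vol_ball]; exact mul_ne_zero (e_ne_zero _) (om_ne_zero n)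

lemma vol_ne_top {n : ℕ} (x : En n) (k : ℤ) :
    volume (Metric.closedBall x ((2:ℝ) ^ (k:ℝ))) ≠ ⊤ := by
  rw [vol_ball]; exact ENNReal.mul_ne_top (e_ne_top _) (om_ne_top n)

/-- average over the dyadic ball -/
def avg {n : ℕ} (f : En n → ℝ≥0∞) (k : ℤ) (x : En n) : ℝ≥0∞ :=
  (volume (Metric.closedBall x ((2:ℝ) ^ (k:ℝ))))⁻¹ *
    ∫⁻ y in Metric.closedBall x ((2:ℝ) ^ (k:ℝ)), f y

/-- Hardy-Littlewood maximal function over dyadic radii. -/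
def HLM {n : ℕ} (f : En n → ℝ≥0∞) (x : En n) : ℝ≥0∞ := ⨆ k : ℤ, avg f k x

lemma avg_measurable {n : ℕ} {f : En n → ℝ≥0∞} (hf : Measurable f) (k : ℤ) :
    Measurable (avg f k) := by
  unfold avg
  simp_rw [vol_ball]
  refine Measurable.const_mul ?_ _
  have : (fun x : En n => ∫⁻ y in Metric.closedBall x ((2:ℝ) ^ (k:ℝ)), f y) =
      fun x => ∫⁻ y, ({z : En n × En n | dist z.2 z.1 ≤ (2:ℝ) ^ (k:ℝ)}.indicator
        (fun z => f z.2)) (x, y) := by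
    funext x
    rw [← lintegral_indicator Metric.isClosed_closedBall.measurableSet]
    rfl
  rw [this]
  refine Measurable.lintegral_prod_right' (f := ({z : En n × En n | dist z.2 z.1 ≤ (2:ℝ) ^ (k:ℝ)}.indicator
        (fun z => f z.2))) ?_
  refine (hf.comp measurable_snd).indicator ?_
  exact (isClosed_le (by fun_prop) continuous_const).measurableSet

lemma HLM_measurable {n : ℕ} {f : En n → ℝ≥0∞} (hf : Measurable f) : Measurable (HLM f) :=
  Measurable.iSup fun k => avg_measurable hf k

open Metric in
lemma weak_aux {n : ℕ} (f : En n → ℝ≥0∞) (t : ℝ≥0∞) (K : ℤ) :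
    t * volume {x | ∃ k : ℤ, k ≤ K ∧ t < avg f k x} ≤ 5 ^ n * ∫⁻ y, f y := by
  set T := {x : En n | ∃ k : ℤ, k ≤ K ∧ t < avg f k x} with hT
  have hT' : ∀ x : En n, ∃ k : ℤ, x ∈ T → (k ≤ K ∧ t < avg f k x) := by
    intro x
    by_cases hx : x ∈ T
    · obtain ⟨k, hk⟩ := hx
      exact ⟨k, fun _ => hk⟩
    · exact ⟨0, fun h => absurd h hx⟩
  choose κ hκ using hT'
  obtain ⟨u, huT, hdis, hcov⟩ := Vitali.exists_disjoint_subfamily_covering_enlargement_closedBall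
    T (fun x => x) (fun x => (2:ℝ) ^ (κ x : ℝ)) ((2:ℝ) ^ (K:ℝ))
    (fun x hx => Real.rpow_le_rpow_of_exponent_le (by norm_num) (by exact_mod_cast (hκ x hx).1))
    5 (by norm_num)
  have hcount : u.Countable := by
    refine hdis.countable_of_nonempty_interior fun x _ => ?_
    exact ⟨x, ball_subset_interior_closedBall (mem_ball_self (by positivity))⟩
  have hsub : T ⊆ ⋃ x ∈ u, closedBall x (5 * (2:ℝ) ^ (κ x : ℝ)) := by
    intro x hx
    obtain ⟨b, hb, hb2⟩ := hcov x hx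
    exact Set.mem_biUnion hb (hb2 (mem_closedBall_self (by positivity)))
  have h5 : ∀ x : En n, volume (closedBall x (5 * (2:ℝ) ^ (κ x : ℝ))) =
      5 ^ n * volume (closedBall x ((2:ℝ) ^ (κ x : ℝ))) := by
    intro x
    rw [Measure.addHaar_closedBall _ _ (by positivity), Measure.addHaar_closedBall _ _ (by positivity),
      mul_pow, ENNReal.ofReal_mul (by positivity), mul_assoc, finrank_euclideanSpace_fin,
      ENNReal.ofReal_pow (by norm_num)]
    norm_num
  have := hcount.to_subtype
  calc t * volume T ≤ t * ∑' x : u, volume (closedBall (x : En n) (5 * (2:ℝ) ^ (κ x : ℝ))) := by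
        gcongr
        exact (measure_mono hsub).trans (measure_biUnion_le _ hcount _)
    _ = 5 ^ n * ∑' x : u, t * volume (closedBall (x : En n) ((2:ℝ) ^ (κ x : ℝ))) := by
        simp_rw [h5]
        rw [ENNReal.tsum_mul_left, ENNReal.tsum_mul_left]
        ring
    _ ≤ 5 ^ n * ∑' x : u, ∫⁻ y in closedBall (x : En n) ((2:ℝ) ^ (κ x : ℝ)), f y := by
        gcongr with x
        have := (hκ x (huT x.2)).2.le
        unfold avg at this
        rw [← ENNReal.div_eq_inv_mul, ENNReal.le_div_iff_mul_le
          (Or.inl (vol_ne_zero _ _)) (Or.inl (vol_ne_top _ _))] at this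
        exact this
    _ = 5 ^ n * ∫⁻ y in ⋃ x ∈ u, closedBall x ((2:ℝ) ^ (κ x : ℝ)), f y := by
        rw [lintegral_biUnion hcount (fun x _ => isClosed_closedBall.measurableSet) hdis]
    _ ≤ _ := by
        exact mul_le_mul_right (setLIntegral_le_lintegral _ _) _

lemma weak_type {n : ℕ} (f : En n → ℝ≥0∞) (t : ℝ≥0∞) :
    t * volume {x | t < HLM f x} ≤ 5 ^ n * ∫⁻ y, f y := by
  have : {x | t < HLM f x} = ⋃ K : ℤ, {x | ∃ k : ℤ, k ≤ K ∧ t < avg f k x} := by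
    ext x
    simp only [HLM, Set.mem_ofPred_eq, lt_iSup_iff, Set.mem_iUnion]
    constructor
    · rintro ⟨k, hk⟩; exact ⟨k, k, le_rfl, hk⟩
    · rintro ⟨_, k, _, hk⟩; exact ⟨k, hk⟩
  rw [this, Monotone.measure_iUnion, ENNReal.mul_iSup]
  · exact iSup_le fun K => weak_aux f t K
  · intro a b hab x ⟨k, hk, h⟩
    exact ⟨k, hk.trans hab, h⟩

lemma HLM_trunc {n : ℕ} {f : En n → ℝ≥0∞} (t : ℝ≥0∞) (x : En n) :
    HLM f x ≤ HLM ({y | t < f y}.indicator f) x + t := by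
  refine iSup_le fun k => ?_
  refine le_trans ?_ (add_le_add_left (le_iSup (fun k => avg ({y | t < f y}.indicator f) k x) k) t)
  unfold avg
  calc _ ≤ (volume (Metric.closedBall x ((2:ℝ) ^ (k:ℝ))))⁻¹ *
      ∫⁻ y in Metric.closedBall x ((2:ℝ) ^ (k:ℝ)), ({y | t < f y}.indicator f y + t) := by
        gcongr with y
        by_cases h : t < f y
        · simp [Set.indicator, h]
        · simpa [Set.indicator, h] using not_lt.1 h
    _ = _ := by
        rw [lintegral_add_right _ measurable_const, setLIntegral_const, mul_add]
        congr 1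
        rw [mul_comm t, ← mul_assoc, ENNReal.inv_mul_cancel (vol_ne_zero _ _) (vol_ne_top _ _),
          one_mul]

lemma strong_type {n : ℕ} {q : ℝ} (hq : 1 < q) {f : En n → ℝ≥0∞} (hf : Measurable f) :
    ∫⁻ x, HLM f x ^ q ≤ (5 ^ n * 2 ^ (q + 1) * (2 ^ (q - 1) * SS (q - 1))) * ∫⁻ x, f x ^ q := by
  have hm := HLM_measurable hf
  have key : ∀ j : ℤ, (2:ℝ≥0∞) ^ ((j + 1) * q) * volume {x | (2:ℝ≥0∞) ^ (j:ℝ) < HLM f x} ≤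
      (5 ^ n * 2 ^ (q + 1)) * ∫⁻ y, f y * (if (2:ℝ≥0∞) ^ ((j:ℝ) - 1) < f y then
        (2:ℝ≥0∞) ^ (j * (q - 1)) else 0) := by
    intro j
    set τ := (2:ℝ≥0∞) ^ ((j:ℝ) - 1) with hτ
    have h2 : (2:ℝ≥0∞) ^ (j:ℝ) = τ + τ := by
      rw [← two_mul, hτ]
      nth_rw 2 [← ENNReal.rpow_one 2]
      rw [← e_add]; congr 1; ring
    have hsub : {x | (2:ℝ≥0∞) ^ (j:ℝ) < HLM f x} ⊆
        {x | τ < HLM ({y | τ < f y}.indicator f) x} := by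
      intro x hx
      simp only [Set.mem_ofPred_eq] at hx ⊢
      by_contra hcon
      have := (hx.trans_le (HLM_trunc τ x)).trans_le (add_le_add_left (not_lt.1 hcon) τ)
      rw [h2] at this
      exact lt_irrefl _ this
    calc _ ≤ (2:ℝ≥0∞) ^ ((j + 1) * q) * volume {x | τ < HLM ({y | τ < f y}.indicator f) x} := by
          gcongr
      _ = (2:ℝ≥0∞) ^ (q + 1 + j * (q - 1)) *
            (τ * volume {x | τ < HLM ({y | τ < f y}.indicator f) x}) := by
          rw [← mul_assoc, hτ, ← e_add]; congr 2; ring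
      _ ≤ (2:ℝ≥0∞) ^ (q + 1 + j * (q - 1)) * (5 ^ n * ∫⁻ y, {y | τ < f y}.indicator f y) := by
          exact mul_le_mul_right (weak_type _ _) _
      _ = (5 ^ n * 2 ^ (q + 1)) * (2 ^ (j * (q - 1)) * ∫⁻ y, {y | τ < f y}.indicator f y) := by
          rw [e_add]; ring
      _ = _ := by
          rw [← lintegral_const_mul' _ _ (e_ne_top _)]
          congr 2
          funext y
          simp only [Set.indicator, Set.mem_ofPred_eq]
          split_ifs <;> simp [mul_comm]
  calc ∫⁻ x, HLM f x ^ q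
      ≤ ∫⁻ x, ∑' j : ℤ, if (2:ℝ≥0∞) ^ (j:ℝ) < HLM f x then (2:ℝ≥0∞) ^ ((j + 1) * q) else 0 :=
        lintegral_mono fun x => layer_upper (by linarith) _
    _ = ∑' j : ℤ, ∫⁻ x, if (2:ℝ≥0∞) ^ (j:ℝ) < HLM f x then (2:ℝ≥0∞) ^ ((j + 1) * q) else 0 := by
        refine lintegral_tsum fun j => Measurable.aemeasurable ?_
        exact Measurable.ite (measurableSet_lt measurable_const hm) measurable_const
          measurable_const
    _ = ∑' j : ℤ, (2:ℝ≥0∞) ^ ((j + 1) * q) * volume {x | (2:ℝ≥0∞) ^ (j:ℝ) < HLM f x} := by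
        congr 1; funext j
        rw [← lintegral_indicator_const (measurableSet_lt measurable_const hm)]
        congr 1; funext x
        simp only [Set.indicator, Set.mem_ofPred_eq]
    _ ≤ ∑' j : ℤ, (5 ^ n * 2 ^ (q + 1)) * ∫⁻ y, f y * (if (2:ℝ≥0∞) ^ ((j:ℝ) - 1) < f y then
        (2:ℝ≥0∞) ^ (j * (q - 1)) else 0) := ENNReal.tsum_le_tsum key
    _ = (5 ^ n * 2 ^ (q + 1)) * ∫⁻ y, ∑' j : ℤ, f y * (if (2:ℝ≥0∞) ^ ((j:ℝ) - 1) < f y then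
        (2:ℝ≥0∞) ^ (j * (q - 1)) else 0) := by
        rw [ENNReal.tsum_mul_left, lintegral_tsum]
        intro j
        exact (hf.mul (Measurable.ite (measurableSet_lt measurable_const hf) measurable_const
          measurable_const)).aemeasurable
    _ ≤ (5 ^ n * 2 ^ (q + 1)) * ∫⁻ y, (2 ^ (q - 1) * SS (q - 1)) * f y ^ q := by
        gcongr with y
        rw [ENNReal.tsum_mul_left]
        calc _ ≤ f y * ((2 ^ (q - 1) * SS (q - 1)) * f y ^ (q - 1)) := by
              gcongr
              exact layer_lower (by linarith) _
          _ = (2 ^ (q - 1) * SS (q - 1)) * (f y ^ (1:ℝ) * f y ^ (q - 1)) := by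
              rw [ENNReal.rpow_one]; ring
          _ = _ := by
              rw [← ENNReal.rpow_add_of_nonneg _ _ zero_le_one (by linarith)]; congr 2; ring
    _ = _ := by
        rw [lintegral_const_mul _ (hf.pow_const q), mul_assoc]
        ring

lemma cube_eq {n : ℕ} (c : En n) {r : ℝ} (hr : 0 < r) :
    cube c r = (WithLp.ofLp : En n → (Fin n → ℝ)) ⁻¹' Metric.ball (WithLp.ofLp c) r := by
  ext y
  simp [cube, dist_pi_lt_iff hr, Real.dist_eq]

lemma cube_meas {n : ℕ} (c : En n) (r : ℝ) : MeasurableSet (cube c r) := by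
  have : cube c r = ⋂ i, {y : En n | |y i - c i| < r} := by
    ext y; simp [cube]
  rw [this]
  refine MeasurableSet.iInter fun i => ?_
  exact (isOpen_lt (by fun_prop) continuous_const).measurableSet

lemma cube_vol {n : ℕ} (c : En n) {r : ℝ} (hr : 0 < r) :
    volume (cube c r) = ENNReal.ofReal (2 * r) ^ n := by
  rw [cube_eq c hr, (PiLp.volume_preserving_ofLp (Fin n)).measure_preimage
    Metric.isOpen_ball.measurableSet.nullMeasurableSet, Real.volume_pi_ball _ hr,
    ENNReal.ofReal_pow (by positivity), Fintype.card_fin]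

lemma cube_vol_ne_zero {n : ℕ} (c : En n) {r : ℝ} (hr : 0 < r) : volume (cube c r) ≠ 0 := by
  rw [cube_vol c hr]
  exact pow_ne_zero _ (by simpa using hr)

lemma cube_vol_ne_top {n : ℕ} (c : En n) {r : ℝ} (hr : 0 < r) : volume (cube c r) ≠ ⊤ := by
  rw [cube_vol c hr]
  exact ENNReal.pow_ne_top ENNReal.ofReal_ne_top

lemma morrey_le {n : ℕ} {p q : ℝ} (f : En n → ℝ≥0∞)
    (c : En n) {r : ℝ} (hr : 0 < r) :
    (∫⁻ y in cube c r, f y ^ q) ^ (1 / q) ≤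
      volume (cube c r) ^ (1 / q - 1 / p) * morreyNormE p q f := by
  have h : volume (cube c r) ^ (1 / p - 1 / q) * (∫⁻ y in cube c r, f y ^ q) ^ (1 / q) ≤
      morreyNormE p q f :=
    le_iSup_of_le c (le_iSup_of_le r (le_iSup_of_le hr le_rfl))
  calc _ = volume (cube c r) ^ (1 / q - 1 / p) *
        (volume (cube c r) ^ (1 / p - 1 / q) * (∫⁻ y in cube c r, f y ^ q) ^ (1 / q)) := by
        rw [← mul_assoc, ← ENNReal.rpow_add _ _ (cube_vol_ne_zero c hr) (cube_vol_ne_top c hr)]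
        simp
    _ ≤ _ := by gcongr

lemma cube_Lq {n : ℕ} {p q : ℝ} (hq : 1 < q) (f : En n → ℝ≥0∞)
    (c : En n) {r : ℝ} (hr : 0 < r) :
    ∫⁻ y in cube c r, f y ^ q ≤
      volume (cube c r) ^ (1 - q / p) * morreyNormE p q f ^ q := by
  have hq0 : 0 < q := by linarith
  have := ENNReal.rpow_le_rpow (morrey_le (p := p) (q := q) f c hr) hq0.le
  rw [← ENNReal.rpow_mul, one_div_mul_cancel hq0.ne', ENNReal.rpow_one,
    ENNReal.mul_rpow_of_nonneg _ _ hq0.le, ← ENNReal.rpow_mul] at this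
  convert this using 3
  field_simp

lemma cube_L1 {n : ℕ} {p q : ℝ} (hq : 1 < q) {f : En n → ℝ≥0∞} (hf : Measurable f)
    (c : En n) {r : ℝ} (hr : 0 < r) :
    ∫⁻ y in cube c r, f y ≤ volume (cube c r) ^ (1 - 1 / p) * morreyNormE p q f := by
  have hc := Real.HolderConjugate.conjExponent hq
  have h := ENNReal.lintegral_mul_le_Lp_mul_Lq (volume.restrict (cube c r)) hc
    hf.aemeasurable (g := fun _ => 1) aemeasurable_const
  simp only [Pi.mul_apply, mul_one, ENNReal.one_rpow, lintegral_one,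
    Measure.restrict_apply_univ] at h
  have e1 : 1 / Real.conjExponent q = 1 - 1 / q := by
    have := hc.inv_add_inv_eq_one
    rw [one_div, one_div]; linarith
  rw [e1] at h
  calc _ ≤ _ := h
    _ ≤ (volume (cube c r) ^ (1 / q - 1 / p) * morreyNormE p q f) *
          volume (cube c r) ^ (1 - 1 / q) := by
        gcongr; exact morrey_le f c hr
    _ = (volume (cube c r) ^ (1 / q - 1 / p) * volume (cube c r) ^ (1 - 1 / q)) *
          morreyNormE p q f := by ring
    _ = _ := by
        rw [← ENNReal.rpow_add _ _ (cube_vol_ne_zero c hr) (cube_vol_ne_top c hr)]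
        congr 2; ring

lemma ofReal_e (x : ℝ) : ENNReal.ofReal ((2:ℝ) ^ x) = 2 ^ x := by
  rw [← ENNReal.ofReal_rpow_of_pos (by norm_num)]; norm_num

lemma ball_L1 {n : ℕ} {p q : ℝ} (hq : 1 < q) {f : En n → ℝ≥0∞} (hf : Measurable f)
    (x : En n) (k : ℤ) :
    ∫⁻ y in Metric.closedBall x ((2:ℝ) ^ (k:ℝ)), f y ≤
      2 ^ ((k + 2) * (n:ℝ) * (1 - 1 / p)) * morreyNormE p q f := by
  have hr : (0:ℝ) < (2:ℝ) ^ ((k:ℝ) + 1) := by positivity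
  have hsub : Metric.closedBall x ((2:ℝ) ^ (k:ℝ)) ⊆ cube x ((2:ℝ) ^ ((k:ℝ) + 1)) := by
    intro y hy i
    have h1 : |y i - x i| ≤ dist y x := by
      rw [dist_eq_norm]
      exact PiLp.norm_apply_le (y - x) i
    refine (h1.trans (Metric.mem_closedBall.1 hy)).trans_lt ?_
    exact Real.rpow_lt_rpow_of_exponent_lt (by norm_num) (by linarith)
  refine (lintegral_mono_set hsub).trans ((cube_L1 (p := p) hq hf x hr).trans_eq ?_)
  rw [cube_vol x hr]
  have : 2 * (2:ℝ) ^ ((k:ℝ) + 1) = (2:ℝ) ^ ((k:ℝ) + 2) := by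
    rw [show (k:ℝ) + 2 = (k + 1) + 1 by ring, Real.rpow_add_one (by norm_num) ((k:ℝ) + 1)]; ring
  rw [this, ofReal_e, ENNReal.rpow_mul (2:ℝ≥0∞) _ (1 - 1 / p), ENNReal.rpow_mul,
    ENNReal.rpow_natCast]

lemma HLM_local {n : ℕ} {p q : ℝ} (hq : 1 < q) (hqp : q ≤ p) {f : En n → ℝ≥0∞}
    (hf : Measurable f) (c : En n) {r : ℝ} (hr : 0 < r) {x : En n} (hx : x ∈ cube c r) :
    HLM f x ≤ HLM ((cube c (2 * r)).indicator f) x +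
      (volume (Metric.ball (0 : En n) 1))⁻¹ * 2 ^ (2 * n - n / p) *
        (volume (cube c r) ^ (-(1 / p)) * morreyNormE p q f) := by
  have hp : 0 < p := by linarith
  refine iSup_le fun k => ?_
  rcases lt_or_ge ((2:ℝ) ^ (k:ℝ)) r with hk | hk
  · refine le_trans ?_ le_self_add
    refine le_trans ?_ (le_iSup (fun k => avg ((cube c (2 * r)).indicator f) k x) k)
    unfold avg
    refine mul_le_mul_right ?_ _
    refine setLIntegral_mono' Metric.isClosed_closedBall.measurableSet fun y hy => ?_
    have : y ∈ cube c (2 * r) := by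
      intro i
      have h1 : |y i - x i| ≤ dist y x := by
        rw [dist_eq_norm]
        exact PiLp.norm_apply_le (y - x) i
      have h2 := hx i
      have h3 := Metric.mem_closedBall.1 hy
      have h4 := abs_add_le (y i - x i) (x i - c i)
      rw [sub_add_sub_cancel] at h4
      linarith
    rw [Set.indicator_of_mem this]
  · refine le_trans ?_ le_add_self
    unfold avg
    set N := morreyNormE p q f
    set om := volume (Metric.ball (0 : En n) 1)
    have hV : (2:ℝ≥0∞) ^ (-((k + 1) * (n:ℝ) * (1 / p))) ≤ volume (cube c r) ^ (-(1 / p)) := by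
      rw [ENNReal.rpow_neg, ENNReal.rpow_neg]
      refine ENNReal.inv_le_inv.2 ?_
      rw [ENNReal.rpow_mul, cube_vol c hr, ENNReal.rpow_mul, ENNReal.rpow_natCast]
      have : ENNReal.ofReal (2 * r) ≤ 2 ^ ((k:ℝ) + 1) := by
        rw [← ofReal_e]
        apply ENNReal.ofReal_le_ofReal
        rw [Real.rpow_add_one (by norm_num)]; linarith
      gcongr
    calc _ ≤ (2 ^ (k * (n:ℝ)) * om)⁻¹ * (2 ^ ((k + 2) * (n:ℝ) * (1 - 1 / p)) * N) := by
          rw [vol_ball]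
          exact mul_le_mul_right (ball_L1 hq hf x k) _
      _ = om⁻¹ * (2 ^ (-(k * (n:ℝ))) * 2 ^ ((k + 2) * (n:ℝ) * (1 - 1 / p))) * N := by
          rw [ENNReal.mul_inv (Or.inl (e_ne_zero _)) (Or.inl (e_ne_top _)), ENNReal.rpow_neg]
          ring
      _ = om⁻¹ * (2 ^ (2 * n - n / p) * 2 ^ (-((k + 1) * (n:ℝ) * (1 / p)))) * N := by
          rw [← e_add, ← e_add]; congr 3; ring
      _ ≤ om⁻¹ * (2 ^ (2 * n - n / p) * volume (cube c r) ^ (-(1 / p))) * N := by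
          exact mul_le_mul_left (mul_le_mul_right (mul_le_mul_right hV _) _) _
      _ = _ := by ring

lemma HLM_morrey (n : ℕ) {p q : ℝ} (hq : 1 < q) (hqp : q ≤ p) :
    ∃ C : ℝ≥0∞, C ≠ ⊤ ∧ ∀ f : En n → ℝ≥0∞, Measurable f → ∀ (c : En n) (r : ℝ), 0 < r →
      ∫⁻ x in cube c r, HLM f x ^ q ≤
        C * (volume (cube c r) ^ (1 - q / p) * morreyNormE p q f ^ q) := by
  have hp : 0 < p := by linarith
  have hq0 : 0 < q := by linarith
  set Cs : ℝ≥0∞ := 5 ^ n * 2 ^ (q + 1) * (2 ^ (q - 1) * SS (q - 1)) with hCs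
  set Cb : ℝ≥0∞ := (volume (Metric.ball (0 : En n) 1))⁻¹ * 2 ^ (2 * n - n / p) with hCb
  have hCst : Cs ≠ ⊤ := by
    refine ENNReal.mul_ne_top (ENNReal.mul_ne_top (by finiteness) (e_ne_top _))
      (ENNReal.mul_ne_top (e_ne_top _) (SS_ne_top (by linarith)))
  have hCbt : Cb ≠ ⊤ := ENNReal.mul_ne_top (ENNReal.inv_ne_top.2 (om_ne_zero n)) (e_ne_top _)
  refine ⟨2 ^ (q - 1) * (Cs * ((2:ℝ≥0∞) ^ n) ^ (1 - q / p) + Cb ^ q), ?_, ?_⟩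
  · refine ENNReal.mul_ne_top (e_ne_top _) (ENNReal.add_ne_top.2
      ⟨ENNReal.mul_ne_top hCst ?_, ENNReal.rpow_ne_top_of_nonneg hq0.le hCbt⟩)
    refine ENNReal.rpow_ne_top_of_nonneg ?_ (by finiteness)
    rw [sub_nonneg, div_le_one hp]; exact hqp
  intro f hf c r hr
  set N := morreyNormE p q f with hN
  set V := volume (cube c r) with hVdef
  have hV2 : volume (cube c (2 * r)) = 2 ^ n * V := by
    rw [hVdef, cube_vol c hr, cube_vol c (by positivity), ENNReal.ofReal_mul (by norm_num), mul_pow]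
    norm_num
  have hV0 := cube_vol_ne_zero c hr
  have hVt := cube_vol_ne_top c hr
  have hf1 : Measurable ((cube c (2 * r)).indicator f) := hf.indicator (cube_meas _ _)
  have hqp' : 0 ≤ 1 - q / p := by
    rw [sub_nonneg, div_le_one hp]; exact hqp
  calc ∫⁻ x in cube c r, HLM f x ^ q
      ≤ ∫⁻ x in cube c r, 2 ^ (q - 1) * (HLM ((cube c (2 * r)).indicator f) x ^ q +
          (Cb * (V ^ (-(1 / p)) * N)) ^ q) := by
        refine setLIntegral_mono' (cube_meas _ _) fun x hx => ?_
        refine (ENNReal.rpow_le_rpow (HLM_local hq hqp hf c hr hx) hq0.le).trans ?_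
        exact ENNReal.rpow_add_le_mul_rpow_add_rpow _ _ hq.le
    _ = 2 ^ (q - 1) * ((∫⁻ x in cube c r, HLM ((cube c (2 * r)).indicator f) x ^ q) +
          (Cb * (V ^ (-(1 / p)) * N)) ^ q * V) := by
        rw [lintegral_const_mul' _ _ (e_ne_top _), lintegral_add_right _ measurable_const,
          setLIntegral_const]
    _ ≤ 2 ^ (q - 1) * (Cs * (((2:ℝ≥0∞) ^ n) ^ (1 - q / p) * V ^ (1 - q / p) * N ^ q) +
          Cb ^ q * (V ^ (1 - q / p) * N ^ q)) := by
        refine mul_le_mul_right (add_le_add ?_ ?_) _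
        · refine (setLIntegral_le_lintegral _ _).trans ((strong_type hq hf1).trans ?_)
          refine mul_le_mul_right ?_ _
          have : ∀ x, (cube c (2 * r)).indicator f x ^ q =
              (cube c (2 * r)).indicator (fun x => f x ^ q) x := by
            intro x
            by_cases h : x ∈ cube c (2 * r) <;> simp [h, hq0]
          simp_rw [this]
          rw [lintegral_indicator (cube_meas _ _)]
          refine (cube_Lq (p := p) hq f c (by positivity)).trans_eq ?_
          rw [hV2, ENNReal.mul_rpow_of_nonneg _ _ hqp']
        · rw [ENNReal.mul_rpow_of_nonneg Cb _ hq0.le, ENNReal.mul_rpow_of_nonneg _ N hq0.le,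
            ← ENNReal.rpow_mul]
          refine le_of_eq ?_
          have : V ^ (1 - q / p) = V ^ (-(1 / p) * q) * V := by
            nth_rw 3 [← ENNReal.rpow_one V]
            rw [← ENNReal.rpow_add _ _ hV0 hVt]; congr 1; ring
          rw [this]; ring
    _ = _ := by ring

lemma frac_sum {n : ℕ} {α : ℝ} (hα : 0 < α) (hαn : α < n) {f : En n → ℝ≥0∞}
    (hf : Measurable f) (x : En n) :
    fracIntegral α f x ≤ ∑' k : ℤ, 2 ^ (-((k - 1) * (n - α))) *
      ∫⁻ y in Metric.closedBall x ((2:ℝ) ^ (k:ℝ)), f y := by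
  have hn : 0 < n := by
    have : (0:ℝ) < n := hα.trans hαn
    exact_mod_cast this
  have : NeZero n := ⟨hn.ne'⟩
  have hna : 0 < (n:ℝ) - α := by linarith
  have hae : ∀ᵐ y : En n, y ≠ x := by
    rw [ae_iff]
    simp
  have hB : ∀ k : ℤ, MeasurableSet (Metric.closedBall x ((2:ℝ) ^ (k:ℝ))) :=
    fun k => Metric.isClosed_closedBall.measurableSet
  calc fracIntegral α f x
      ≤ ∫⁻ y, ∑' k : ℤ, 2 ^ (-((k - 1) * (n - α))) *
          (Metric.closedBall x ((2:ℝ) ^ (k:ℝ))).indicator f y := by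
        unfold fracIntegral
        refine lintegral_mono_ae ?_
        filter_upwards [hae] with y hy
        obtain ⟨m, h1, h2⟩ := ENNReal.exists_mem_Ioc_zpow (x := edist x y) (y := 2)
          (by simpa [edist_eq_zero] using hy.symm) (edist_ne_top _ _) (by norm_num) (by norm_num)
        rw [← ENNReal.rpow_intCast] at h1 h2
        refine le_trans ?_ (ENNReal.le_tsum (m + 1))
        have hy : y ∈ Metric.closedBall x ((2:ℝ) ^ ((m + 1 : ℤ):ℝ)) := by
          rw [Metric.mem_closedBall, dist_comm]
          rw [edist_dist, ← ofReal_e] at h2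
          exact (ENNReal.ofReal_le_ofReal_iff (by positivity)).1 h2
        rw [Set.indicator_of_mem hy, ENNReal.div_eq_inv_mul]
        refine mul_le_mul_left ?_ _
        rw [ENNReal.rpow_neg]
        refine ENNReal.inv_le_inv.2 ?_
        rw [ENNReal.rpow_mul]
        refine ENNReal.rpow_le_rpow ?_ hna.le
        push_cast
        simpa using h1.le
    _ = _ := by
        rw [lintegral_tsum]
        · congr 1; funext k
          rw [lintegral_const_mul' _ _ (e_ne_top _), lintegral_indicator (hB k)]
        · intro k
          exact ((hf.indicator (hB k)).const_mul _).aemeasurable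

lemma frac_pointwise (n : ℕ) {α p q : ℝ} (hα : 0 < α) (hαn : α < n) (hq : 1 < q) (hqp : q ≤ p)
    (hβ : 0 < n / p - α) :
    ∃ C : ℝ≥0∞, C ≠ ⊤ ∧ ∀ f : En n → ℝ≥0∞, Measurable f → ∀ x : En n,
      fracIntegral α f x ≤ C * (HLM f x ^ ((n / p - α) / (n / p)) *
        morreyNormE p q f ^ (α / (n / p))) := by
  set β := n / p - α with hβdef
  have hp : 0 < p := by linarith
  have hs : α + β = n / p := by rw [hβdef]; ring
  have hs0 : 0 < α + β := by linarith
  set om := volume (Metric.ball (0 : En n) 1) with hom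
  set Cn : ℝ≥0∞ := 2 ^ (2 * (n:ℝ) * (1 - 1 / p)) with hCn
  refine ⟨2 ^ ((n:ℝ) - α) * ((2 ^ β * SS (min α β)) *
    (om ^ (β / (n / p)) * Cn ^ (α / (n / p)))), ?_, ?_⟩
  · rw [← hs]
    refine ENNReal.mul_ne_top (e_ne_top _) (ENNReal.mul_ne_top (ENNReal.mul_ne_top (e_ne_top _)
      (SS_ne_top (lt_min hα hβ))) (ENNReal.mul_ne_top ?_ ?_))
    · exact ENNReal.rpow_ne_top_of_nonneg (by positivity) (om_ne_top n)
    · exact ENNReal.rpow_ne_top_of_nonneg (by positivity) (e_ne_top _)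
  intro f hf x
  set N := morreyNormE p q f
  have hterm : ∀ k : ℤ, (2:ℝ≥0∞) ^ (-((k - 1) * ((n:ℝ) - α))) *
      ∫⁻ y in Metric.closedBall x ((2:ℝ) ^ (k:ℝ)), f y ≤
      2 ^ ((n:ℝ) - α) * min ((om * HLM f x) * 2 ^ (k * α)) ((Cn * N) * 2 ^ (-(k * β))) := by
    intro k
    have h0 : (2:ℝ≥0∞) ^ (-((k - 1) * ((n:ℝ) - α))) =
        2 ^ ((n:ℝ) - α) * 2 ^ (-(k * ((n:ℝ) - α))) := by
      rw [← e_add]; congr 1; ring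
    rw [h0, mul_assoc]
    refine mul_le_mul_right (le_min ?_ ?_) _
    · have h1 : ∫⁻ y in Metric.closedBall x ((2:ℝ) ^ (k:ℝ)), f y ≤
          (2 ^ (k * (n:ℝ)) * om) * HLM f x := by
        have h2 : avg f k x ≤ HLM f x := le_iSup (fun k => avg f k x) k
        rw [hom, ← vol_ball x k]
        unfold avg at h2
        rw [← ENNReal.div_eq_inv_mul, ENNReal.div_le_iff (vol_ne_zero _ _) (vol_ne_top _ _)] at h2
        rw [mul_comm]; exact h2
      refine (mul_le_mul_right h1 _).trans_eq ?_
      rw [show k * α = -(k * ((n:ℝ) - α)) + k * (n:ℝ) by ring, e_add]; ring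
    · refine (mul_le_mul_right (ball_L1 (p := p) hq hf x k) _).trans_eq ?_
      rw [← mul_assoc, ← e_add, mul_right_comm Cn N, hCn, ← e_add]
      congr 2
      rw [hβdef]; field_simp; ring
  calc fracIntegral α f x ≤ _ := frac_sum hα hαn hf x
    _ ≤ ∑' k : ℤ, 2 ^ ((n:ℝ) - α) *
        min ((om * HLM f x) * 2 ^ (k * α)) ((Cn * N) * 2 ^ (-(k * β))) :=
        ENNReal.tsum_le_tsum hterm
    _ ≤ 2 ^ ((n:ℝ) - α) * ((2 ^ β * SS (min α β)) *
          ((om * HLM f x) ^ (β / (α + β)) * (Cn * N) ^ (α / (α + β)))) := by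
        rw [ENNReal.tsum_mul_left]
        exact mul_le_mul_right (minsum hα hβ _ _) _
    _ = _ := by
        rw [ENNReal.mul_rpow_of_nonneg _ _ (by positivity),
          ENNReal.mul_rpow_of_nonneg _ _ (by positivity), hs]
        ring

/-- Adams: For `0 < α < n`, `1 < q ≤ p < ∞`, `1 < l ≤ s < ∞` with
`1/s = 1/p - α/n` and `l/s = q/p`, one has `‖I_α f‖_{M^s_l} ≤ C ‖f‖_{M^p_q}` for all
nonnegative measurable `f`, with `C` depending only on `n, α, p, q`. -/
theorem adams_fracIntegral_morrey (n : ℕ) (α p q s l : ℝ)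
    (hα : 0 < α) (hαn : α < n) (hq : 1 < q) (hqp : q ≤ p) (hl : 1 < l) (hls : l ≤ s)
    (hs : 1 / s = 1 / p - α / n) (hlsqp : l / s = q / p) :
    ∃ C : ℝ, 0 < C ∧
      ∀ f : En n → ℝ, Measurable f → (∀ x, 0 ≤ f x) →
        morreyNormE s l (fracIntegral α (fun y => ENNReal.ofReal (f y))) ≤
          ENNReal.ofReal C * morreyNormE p q (fun y => ENNReal.ofReal (f y)) := by
  have hn : (0:ℝ) < n := hα.trans hαn
  have hp : 0 < p := by linarith
  have hs0 : 0 < s := by linarith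
  have hl0 : 0 < l := by linarith
  have hq0 : 0 < q := by linarith
  have hβ' : n / p - α = n / s := by
    have : (n:ℝ) / s = n * (1 / s) := by ring
    rw [this, hs]; field_simp
  have hβ : 0 < n / p - α := by rw [hβ']; positivity
  have hθ : (n / p - α) / (n / p) * l = q := by
    rw [hβ']
    have : (n / s) / (n / p) * l = p * (l / s) := by field_simp
    rw [this, hlsqp]; field_simp
  have hθ' : q + α / (n / p) * l = l := by
    rw [← hθ]; field_simp; ring
  obtain ⟨C1, hC1, H1⟩ := frac_pointwise n hα hαn hq hqp hβ
  obtain ⟨C2, hC2, H2⟩ := HLM_morrey n hq hqp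
  set C : ℝ≥0∞ := C1 * C2 ^ (1 / l) with hC
  have hCt : C ≠ ⊤ := ENNReal.mul_ne_top hC1 (ENNReal.rpow_ne_top_of_nonneg (by positivity) hC2)
  refine ⟨C.toReal + 1, by positivity, ?_⟩
  intro f0 hf0 _
  set f : En n → ℝ≥0∞ := fun y => ENNReal.ofReal (f0 y) with hfdef
  have hf : Measurable f := hf0.ennreal_ofReal
  set N := morreyNormE p q f with hN
  have hle : C ≤ ENNReal.ofReal (C.toReal + 1) := by
    rw [← ENNReal.ofReal_toReal hCt]
    apply ENNReal.ofReal_le_ofReal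
    rw [ENNReal.ofReal_toReal hCt]; linarith
  refine le_trans ?_ (mul_le_mul_left hle N)
  refine iSup_le fun c => iSup_le fun r => iSup_le fun hr => ?_
  have hV0 := cube_vol_ne_zero c hr
  have hVt := cube_vol_ne_top c hr
  set V := volume (cube c r) with hV
  have hα' : 0 ≤ α / (n / p) * l := by positivity
  have hint : ∫⁻ y in cube c r, fracIntegral α f y ^ l ≤
      C1 ^ l * C2 * V ^ (1 - q / p) * N ^ l := by
    calc _ ≤ ∫⁻ y in cube c r, (C1 ^ l * N ^ (α / (n / p) * l)) * HLM f y ^ q := by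
          refine lintegral_mono fun y => ?_
          refine (ENNReal.rpow_le_rpow (H1 f hf y) hl0.le).trans_eq ?_
          rw [ENNReal.mul_rpow_of_nonneg _ _ hl0.le, ENNReal.mul_rpow_of_nonneg _ _ hl0.le,
            ← ENNReal.rpow_mul, ← ENNReal.rpow_mul, hθ]
          ring
      _ = (C1 ^ l * N ^ (α / (n / p) * l)) * ∫⁻ y in cube c r, HLM f y ^ q :=
          lintegral_const_mul _ ((HLM_measurable hf).pow_const q)
      _ ≤ (C1 ^ l * N ^ (α / (n / p) * l)) * (C2 * (V ^ (1 - q / p) * N ^ q)) :=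
          mul_le_mul_right (H2 f hf c r hr) _
      _ = C1 ^ l * C2 * V ^ (1 - q / p) * (N ^ q * N ^ (α / (n / p) * l)) := by ring
      _ = _ := by
          rw [← ENNReal.rpow_add_of_nonneg _ _ hq0.le hα', hθ']
  calc V ^ (1 / s - 1 / l) * (∫⁻ y in cube c r, fracIntegral α f y ^ l) ^ (1 / l)
      ≤ V ^ (1 / s - 1 / l) * (C1 ^ l * C2 * V ^ (1 - q / p) * N ^ l) ^ (1 / l) :=
        mul_le_mul_right (ENNReal.rpow_le_rpow hint (by positivity)) _
    _ = (V ^ (1 / s - 1 / l) * V ^ ((1 - q / p) * (1 / l))) * (C1 * C2 ^ (1 / l) * N) := by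
        have hl' : 0 ≤ 1 / l := by positivity
        rw [ENNReal.mul_rpow_of_nonneg _ _ hl', ENNReal.mul_rpow_of_nonneg _ _ hl',
          ENNReal.mul_rpow_of_nonneg _ _ hl', ← ENNReal.rpow_mul, ← ENNReal.rpow_mul,
          ← ENNReal.rpow_mul, mul_one_div_cancel hl0.ne', ENNReal.rpow_one, ENNReal.rpow_one]
        ring
    _ = C * N := by
        rw [← ENNReal.rpow_add _ _ hV0 hVt]
        have : 1 / s - 1 / l + (1 - q / p) * (1 / l) = 0 := by
          rw [← hlsqp]; field_simp; ring
        rw [this, ENNReal.rpow_zero, one_mul]
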